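/- Let ν ≥ 0, t > 0 be real numbers, d ≥ 1 and I ≥ 1 integers, and let g : ℝ^d → ℝ^d be continuously differentiable. Define F : ℝ^d × ℝ^d → ℝ^d × ℝ^d by F(K, Φ) = (K₊, Φ₊) where K₁ = e^{−νt/2}·K, Φ₁ = Φ − (t/2)·K₁, K₂ = K₁ + t·g(Φ₁), K₊ = e^{−νt/2}·K₂, Φ₊ = Φ₁ + (t/2)·K₂. Then the I-fold iterate F^[I] is differentiable and for every point z ∈ ℝ^d × ℝ^d the determinant of the total derivative of F^[I] at z equals exp(−I ν t d). -/

import Mathlib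

/-- The deterministic quasi-symplectic Langevin integrator step with damping `ν`,
time step `t` and force field `g`: `K₁ = e^{−νt/2}•K`, `Φ₁ = Φ − (t/2)•K₁`,
`K₂ = K₁ + t•g(Φ₁)`, `K₊ = e^{−νt/2}•K₂`, `Φ₊ = Φ₁ + (t/2)•K₂`. -/
noncomputable def qslStep (d : ℕ) (ν t : ℝ)
    (g : EuclideanSpace ℝ (Fin d) → EuclideanSpace ℝ (Fin d)) :
    EuclideanSpace ℝ (Fin d) × EuclideanSpace ℝ (Fin d) →
      EuclideanSpace ℝ (Fin d) × EuclideanSpace ℝ (Fin d) :=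
  fun z =>
    let K₁ := Real.exp (-ν * t / 2) • z.1
    let Φ₁ := z.2 - (t / 2) • K₁
    let K₂ := K₁ + t • g Φ₁
    (Real.exp (-ν * t / 2) • K₂, Φ₁ + (t / 2) • K₂)

namespace LinearMap

variable {R M N : Type*} [CommRing R] [AddCommGroup M] [AddCommGroup N] [Module R M] [Module R N]
  [Module.Free R M] [Module.Free R N] [Module.Finite R M] [Module.Finite R N]

/-- The shear `(x, y) ↦ (x, y + f x)` has determinant one. -/
theorem det_prod_fst_snd_add_comp_fst (f : M →ₗ[R] N) :
    LinearMap.det ((fst R M N).prod (snd R M N + f ∘ₗ fst R M N)) = 1 := by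
  classical
  let b := Module.Free.chooseBasis R M
  let b' := Module.Free.chooseBasis R N
  have h : toMatrix (b.prod b') (b.prod b') ((fst R M N).prod (snd R M N + f ∘ₗ fst R M N)) =
      Matrix.fromBlocks 1 0 (toMatrix b b' f) 1 := by
    ext (i | i) (j | j) <;>
      simp [toMatrix_apply, Matrix.one_apply, Finsupp.single_apply, eq_comm]
  rw [← det_toMatrix (b.prod b'), h, Matrix.det_fromBlocks_zero₁₂, Matrix.det_one, Matrix.det_one,
    mul_one]

/-- The shear `(x, y) ↦ (x + f y, y)` has determinant one. -/
theorem det_prod_fst_add_comp_snd_snd (f : N →ₗ[R] M) :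
    LinearMap.det ((fst R M N + f ∘ₗ snd R M N).prod (snd R M N)) = 1 := by
  classical
  let b := Module.Free.chooseBasis R M
  let b' := Module.Free.chooseBasis R N
  have h : toMatrix (b.prod b') (b.prod b') ((fst R M N + f ∘ₗ snd R M N).prod (snd R M N)) =
      Matrix.fromBlocks 1 (toMatrix b' b f) 0 1 := by
    ext (i | i) (j | j) <;>
      simp [toMatrix_apply, Matrix.one_apply, Finsupp.single_apply, eq_comm]
  rw [← det_toMatrix (b.prod b'), h, Matrix.det_fromBlocks_zero₂₁, Matrix.det_one, Matrix.det_one,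
    mul_one]

end LinearMap

/-- If the derivative of `f` has constant determinant `c`, the derivative of the iterate `f^[n]`
has constant determinant `c ^ n`. -/
theorem Differentiable.det_fderiv_iterate {𝕜 E : Type*} [NontriviallyNormedField 𝕜]
    [NormedAddCommGroup E] [NormedSpace 𝕜 E] {f : E → E} (hf : Differentiable 𝕜 f) {c : 𝕜}
    (hc : ∀ z, LinearMap.det (fderiv 𝕜 f z).toLinearMap = c) (n : ℕ) (z : E) :
    LinearMap.det (fderiv 𝕜 f^[n] z).toLinearMap = c ^ n := by
  induction n generalizing z with
  | zero => simp
  | succ n ih =>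
    rw [Function.iterate_succ, fderiv_comp z (hf.iterate n _) (hf z),
      ContinuousLinearMap.toLinearMap_comp, LinearMap.det_comp, ih, hc, pow_succ]

theorem differentiable_qslStep {d : ℕ} (ν t : ℝ)
    {g : EuclideanSpace ℝ (Fin d) → EuclideanSpace ℝ (Fin d)} (hg : Differentiable ℝ g) :
    Differentiable ℝ (qslStep d ν t g) := by
  unfold qslStep
  fun_prop

theorem det_fderiv_qslStep {d : ℕ} (ν t : ℝ)
    {g : EuclideanSpace ℝ (Fin d) → EuclideanSpace ℝ (Fin d)} (hg : Differentiable ℝ g)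
    (z : EuclideanSpace ℝ (Fin d) × EuclideanSpace ℝ (Fin d)) :
    LinearMap.det (fderiv ℝ (qslStep d ν t g) z).toLinearMap = Real.exp (-(ν * t * d)) := by
  let E := EuclideanSpace ℝ (Fin d)
  let c := Real.exp (-ν * t / 2)
  let G := fderiv ℝ g (z.2 - (t / 2) • c • z.1)
  let damp : E × E →ₗ[ℝ] E × E := (c • LinearMap.id).prodMap LinearMap.id
  let drift (a : ℝ) : E × E →ₗ[ℝ] E × E := (LinearMap.fst ℝ E E).prod
    (LinearMap.snd ℝ E E + (a • LinearMap.id) ∘ₗ LinearMap.fst ℝ E E)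
  let kick : E × E →ₗ[ℝ] E × E := (LinearMap.fst ℝ E E +
    (t • G.toLinearMap) ∘ₗ LinearMap.snd ℝ E E).prod (LinearMap.snd ℝ E E)
  have hK : HasFDerivAt (fun z : E × E => c • z.1) (c • ContinuousLinearMap.fst ℝ E E) z :=
    hasFDerivAt_fst.const_smul c
  have hΦ := (hasFDerivAt_snd (𝕜 := ℝ) (p := z)).sub (hK.const_smul (t / 2))
  have hK' := hK.add (((hg _).hasFDerivAt.comp z hΦ).const_smul t)
  have hF : HasFDerivAt (qslStep d ν t g) _ z :=
    (hK'.const_smul c).prodMk (hΦ.add (hK'.const_smul (t / 2)))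
  have hfactor : (fderiv ℝ (qslStep d ν t g) z).toLinearMap =
      damp ∘ₗ drift (t / 2) ∘ₗ kick ∘ₗ drift (-(t / 2)) ∘ₗ damp := by
    rw [hF.fderiv]
    refine LinearMap.ext fun w => ?_
    simp [damp, drift, kick, G, sub_eq_add_neg]
  have hdamp : LinearMap.det damp = c ^ d := by
    simp [damp, LinearMap.det_prodMap, E]
  have hdrift (a : ℝ) : LinearMap.det (drift a) = 1 := LinearMap.det_prod_fst_snd_add_comp_fst _
  have hkick : LinearMap.det kick = 1 := LinearMap.det_prod_fst_add_comp_snd_snd _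
  rw [hfactor]
  simp only [LinearMap.det_comp, hdamp, hdrift, hkick, one_mul]
  rw [← Real.exp_nat_mul, ← Real.exp_add]
  ring_nf

/-- The `I`-fold iterate of the quasi-symplectic Langevin step is differentiable
with constant Jacobian determinant `exp(−I ν t d)`. -/
theorem qsl_iterate_jacobian_det (d : ℕ) (hd : 1 ≤ d) (I : ℕ) (hI : 1 ≤ I)
    (ν t : ℝ) (hν : 0 ≤ ν) (ht : 0 < t)
    (g : EuclideanSpace ℝ (Fin d) → EuclideanSpace ℝ (Fin d)) (hg : ContDiff ℝ 1 g) :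
    Differentiable ℝ ((qslStep d ν t g)^[I]) ∧
      ∀ z : EuclideanSpace ℝ (Fin d) × EuclideanSpace ℝ (Fin d),
        LinearMap.det (fderiv ℝ ((qslStep d ν t g)^[I]) z).toLinearMap =
          Real.exp (-(I * ν * t * d)) := by
  have hd' := hg.differentiable one_ne_zero
  have hF := differentiable_qslStep ν t hd'
  refine ⟨hF.iterate I, fun z => ?_⟩
  rw [hF.det_fderiv_iterate (det_fderiv_qslStep ν t hd') I z, ← Real.exp_nat_mul]
  ring_nf
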